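/- Let (M_i)_{i=1}^n be a martingale difference sequence (E[M_i | M_1,...,M_{i−1}] = 0 for i ≥ 2 and E M_1 = 0) such that for each i and all q ≥ 1, ‖M_i‖_q ≤ c·K_i·q^{1/α_i} with positive constants c, K_i, α_i. Let α* = min_i α_i and α' = 2α*/(2+α*). Then there is a constant c' (depending only on c) such that for all q ≥ 2, ‖∑_{i=1}^n M_i‖_q ≤ c'·(∑_{i=1}^n K_i²)^{1/2}·q^{1/α'}. -/

import Mathlib

open MeasureTheory Real

/-- Two-point smoothness inequality, normalised so that the first point is `1`. -/
lemma abs_one_add_rpow_add_abs_one_sub_rpow_le (x : ℝ) {q : ℝ} (hq : 2 ≤ q) :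
    |1 + x| ^ q + |1 - x| ^ q ≤ 2 * (1 + 2 * q * x ^ 2) ^ (q / 2) := by
  wlog hx : 0 ≤ x generalizing x
  · have h := this (-x) (by linarith)
    rwa [← sub_eq_add_neg, sub_neg_eq_add, neg_sq, add_comm] at h
  rw [abs_of_nonneg (by linarith : 0 ≤ 1 + x)]
  have hq0 : 0 < q := by linarith
  have hqx : 0 ≤ q * x ^ 2 := by positivity
  rcases le_total (q * x ^ 2) 1 with h | h
  · have hx1 : x ≤ 1 := by nlinarith
    have h1 : (1 + x) ^ q ≤ exp (q * x) := by
      rw [mul_comm q x, exp_mul]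
      exact rpow_le_rpow (by linarith) (by linarith [add_one_le_exp x]) hq0.le
    have h2 : |1 - x| ^ q ≤ exp (-(q * x)) := by
      rw [abs_of_nonneg (by linarith), ← mul_neg, mul_comm q (-x), exp_mul]
      exact rpow_le_rpow (by linarith) (by linarith [add_one_le_exp (-x)]) hq0.le
    have h3 : exp (q * x) + exp (-(q * x)) ≤ 2 * exp ((q * x) ^ 2 / 2) := by
      have := cosh_le_exp_half_sq (q * x)
      rw [cosh_eq] at this
      linarith
    have h4 : exp ((q * x) ^ 2 / 2) ≤ (1 + 2 * q * x ^ 2) ^ (q / 2) := by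
      rw [show (q * x) ^ 2 / 2 = q * x ^ 2 * (q / 2) by ring, exp_mul]
      refine rpow_le_rpow (exp_pos _).le ?_ (by positivity)
      have := (abs_le.1 (abs_exp_sub_one_sub_id_le (x := q * x ^ 2) (by rwa [abs_of_nonneg hqx]))).2
      nlinarith
    linarith
  · have hbase : (1 + x) ^ 2 ≤ 1 + 2 * q * x ^ 2 := by
      nlinarith [sq_nonneg (x - 1), sq_nonneg (q * x - 1), sq_nonneg (q * x - 2)]
    have h1 : (1 + x) ^ q ≤ (1 + 2 * q * x ^ 2) ^ (q / 2) := by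
      calc (1 + x) ^ q = ((1 + x) ^ 2) ^ (q / 2) := by
            rw [← rpow_natCast, ← rpow_mul (by linarith)]
            congr 1
            push_cast
            ring
        _ ≤ _ := rpow_le_rpow (by positivity) hbase (by positivity)
    have h2 : |1 - x| ^ q ≤ (1 + x) ^ q :=
      rpow_le_rpow (abs_nonneg _) (abs_le.2 ⟨by linarith, by linarith⟩) hq0.le
    linarith

/-- Two-point smoothness inequality on the real line. -/
lemma abs_add_rpow_add_abs_sub_rpow_le (a b : ℝ) {q : ℝ} (hq : 2 ≤ q) :
    |a + b| ^ q + |a - b| ^ q ≤ 2 * (a ^ 2 + 2 * q * b ^ 2) ^ (q / 2) := by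
  have hq0 : 0 < q := by linarith
  rcases eq_or_ne a 0 with rfl | ha
  · have h : |b| ^ q ≤ (0 ^ 2 + 2 * q * b ^ 2) ^ (q / 2) := by
      calc |b| ^ q = (b ^ 2) ^ (q / 2) := by
            rw [← sq_abs, ← rpow_natCast, ← rpow_mul (abs_nonneg b)]
            congr 1
            push_cast
            ring
        _ ≤ _ := rpow_le_rpow (by positivity) (by nlinarith [sq_nonneg b]) (by positivity)
    simp only [zero_add, zero_sub, abs_neg] at h ⊢
    simp only [ne_eq, OfNat.ofNat_ne_zero, not_false_eq_true, zero_pow, zero_add] at h ⊢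
    linarith
  have ha' : 0 < |a| := abs_pos.2 ha
  have e1 : |a + b| = |a| * |1 + b / a| := by
    rw [← abs_mul]
    congr 1
    field_simp
  have e2 : |a - b| = |a| * |1 - b / a| := by
    rw [← abs_mul]
    congr 1
    field_simp
  have e3 : (a ^ 2 + 2 * q * b ^ 2) ^ (q / 2) =
      |a| ^ q * (1 + 2 * q * (b / a) ^ 2) ^ (q / 2) := by
    rw [show |a| ^ q = (|a| ^ 2) ^ (q / 2) by
      rw [← rpow_natCast, ← rpow_mul ha'.le]; congr 1; push_cast; ring,
      ← mul_rpow (by positivity) (by positivity)]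
    congr 1
    rw [sq_abs]
    field_simp
  rw [e1, e2, e3, mul_rpow ha'.le (abs_nonneg _), mul_rpow ha'.le (abs_nonneg _), ← mul_add,
    mul_left_comm]
  exact mul_le_mul_of_nonneg_left (abs_one_add_rpow_add_abs_one_sub_rpow_le (b / a) hq)
    (by positivity)

/-- The space `L^q` is 2-uniformly smooth for `q ≥ 2`, with constant of order `q`. -/
lemma eLpNorm_add_sq_add_eLpNorm_sub_sq_le {Ω : Type*} [MeasurableSpace Ω] {μ : Measure Ω}
    {X Y : Ω → ℝ} (hX : AEStronglyMeasurable X μ) (hY : AEStronglyMeasurable Y μ)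
    {q : ℝ} (hq : 2 ≤ q) :
    eLpNorm (X + Y) (ENNReal.ofReal q) μ ^ 2 + eLpNorm (X - Y) (ENNReal.ofReal q) μ ^ 2 ≤
      2 * (eLpNorm X (ENNReal.ofReal q) μ ^ 2 +
        ENNReal.ofReal (2 * q) * eLpNorm Y (ENNReal.ofReal q) μ ^ 2) := by
  have hq0 : 0 < q := by linarith
  have hr : 1 ≤ q / 2 := by linarith
  have hr0 : 0 < q / 2 := by linarith
  have hpow (s : ℝ) (hs : 0 < s) (f : Ω → ℝ) :
      eLpNorm f (ENNReal.ofReal s) μ ^ s = ∫⁻ ω, ‖f ω‖ₑ ^ s ∂μ := by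
    rw [eLpNorm_eq_lintegral_rpow_enorm_toReal (by simpa using hs) ENNReal.ofReal_ne_top,
      ENNReal.toReal_ofReal hs.le, ← ENNReal.rpow_mul, one_div_mul_cancel hs.ne', ENNReal.rpow_one]
  have hsq (f : Ω → ℝ) :
      (eLpNorm f (ENNReal.ofReal q) μ ^ 2) ^ (q / 2) = ∫⁻ ω, ‖f ω‖ₑ ^ q ∂μ := by
    rw [← hpow q hq0, ← ENNReal.rpow_natCast, ← ENNReal.rpow_mul]
    congr 1
    push_cast
    ring
  have hsq' (f : Ω → ℝ) :
      eLpNorm (fun ω => f ω ^ 2) (ENNReal.ofReal (q / 2)) μ = eLpNorm f (ENNReal.ofReal q) μ ^ 2 := by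
    have h := eLpNorm_norm_rpow (μ := μ) (p := ENNReal.ofReal (q / 2)) f (q := 2) two_pos
    rw [← ENNReal.ofReal_mul hr0.le, div_mul_cancel₀ q two_ne_zero] at h
    simpa using h
  set D := eLpNorm ((fun ω => X ω ^ 2) + (2 * q) • fun ω => Y ω ^ 2) (ENNReal.ofReal (q / 2)) μ
    with hD
  have hDle : D ≤ eLpNorm X (ENNReal.ofReal q) μ ^ 2 +
      ENNReal.ofReal (2 * q) * eLpNorm Y (ENNReal.ofReal q) μ ^ 2 := by
    refine (eLpNorm_add_le (hX.pow 2) ((hY.pow 2).const_smul _) (by simpa using hr)).trans ?_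
    rw [eLpNorm_const_smul, enorm_of_nonneg (by positivity)]
    exact (congrArg₂ _ (hsq' X) (congrArg _ (hsq' Y))).le
  have hpt (ω : Ω) : ‖(X + Y) ω‖ₑ ^ q + ‖(X - Y) ω‖ₑ ^ q ≤
      2 * ‖((fun ω => X ω ^ 2) + (2 * q) • fun ω => Y ω ^ 2) ω‖ₑ ^ (q / 2) := by
    have h := ENNReal.ofReal_le_ofReal (abs_add_rpow_add_abs_sub_rpow_le (X ω) (Y ω) hq)
    rw [ENNReal.ofReal_add (by positivity) (by positivity), ENNReal.ofReal_mul two_pos.le,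
      ← ENNReal.ofReal_rpow_of_nonneg (by positivity) hq0.le,
      ← ENNReal.ofReal_rpow_of_nonneg (by positivity) hq0.le,
      ← ENNReal.ofReal_rpow_of_nonneg (by positivity) hr0.le] at h
    simp only [Pi.add_apply, Pi.sub_apply, Pi.smul_apply, smul_eq_mul]
    rw [enorm_eq_ofReal_abs, enorm_eq_ofReal_abs, enorm_of_nonneg (by positivity)]
    simpa using h
  have hint : (∫⁻ ω, ‖(X + Y) ω‖ₑ ^ q ∂μ) + ∫⁻ ω, ‖(X - Y) ω‖ₑ ^ q ∂μ ≤ 2 * D ^ (q / 2) := by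
    rw [hD, hpow _ hr0, ← lintegral_add_left' ((hX.add hY).enorm.pow_const q),
      ← lintegral_const_mul' _ _ (by simp)]
    exact lintegral_mono hpt
  set A := eLpNorm (X + Y) (ENNReal.ofReal q) μ ^ 2
  set B := eLpNorm (X - Y) (ENNReal.ofReal q) μ ^ 2
  have hmean : (2⁻¹ * A + 2⁻¹ * B) ^ (q / 2) ≤ D ^ (q / 2) := by
    refine (ENNReal.rpow_arith_mean_le_arith_mean2_rpow _ _ A B ENNReal.inv_two_add_inv_two
      hr).trans ?_
    rw [hsq, hsq, ← mul_add]
    refine (mul_le_mul_right hint _).trans ?_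
    rw [← mul_assoc, ENNReal.inv_mul_cancel two_ne_zero ENNReal.ofNat_ne_top, one_mul]
  have hAB := ((ENNReal.rpow_le_rpow_iff hr0).1 hmean).trans hDle
  calc A + B = 2 * (2⁻¹ * A + 2⁻¹ * B) := by
        rw [← mul_add, ← mul_assoc, ENNReal.mul_inv_cancel two_ne_zero ENNReal.ofNat_ne_top,
          one_mul]
    _ ≤ _ := mul_le_mul_right hAB _

/-- Adding a conditionally centred increment to a function measurable with respect to the past. -/
lemma eLpNorm_add_sq_le_of_condExp_eq_zero {Ω : Type*} {m m0 : MeasurableSpace Ω} {μ : Measure Ω}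
    [IsFiniteMeasure μ] (hm : m ≤ m0) {X Y : Ω → ℝ} (hX : StronglyMeasurable[m] X)
    (hXint : Integrable X μ) (hYint : Integrable Y μ) (hY : μ[Y | m] =ᵐ[μ] 0)
    {q : ℝ} (hq : 2 ≤ q) :
    eLpNorm (X + Y) (ENNReal.ofReal q) μ ^ 2 ≤ eLpNorm X (ENNReal.ofReal q) μ ^ 2 +
      ENNReal.ofReal (4 * q) * eLpNorm Y (ENNReal.ofReal q) μ ^ 2 := by
  have hle : eLpNorm X (ENNReal.ofReal q) μ ≤ eLpNorm (X - Y) (ENNReal.ofReal q) μ := by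
    have h : μ[X - Y | m] =ᵐ[μ] X := by
      filter_upwards [condExp_sub hXint hYint m, hY] with ω h1 h2
      rw [h1, Pi.sub_apply, h2, condExp_of_stronglyMeasurable hm hX hXint, Pi.zero_apply, sub_zero]
    rw [← eLpNorm_congr_ae h]
    exact eLpNorm_condExp_le_eLpNorm _ (by simpa using (by linarith : 1 ≤ q))
  have h := eLpNorm_add_sq_add_eLpNorm_sub_sq_le hXint.aestronglyMeasurable
    hYint.aestronglyMeasurable hq
  rcases eq_or_ne (eLpNorm X (ENNReal.ofReal q) μ ^ 2) ⊤ with htop | htop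
  · simp [htop]
  refine ENNReal.le_of_add_le_add_right htop ?_
  calc _ ≤ _ := add_le_add_right (pow_le_pow_left' hle 2) _
    _ ≤ _ := h
    _ = _ := by
      have h4 : ENNReal.ofReal (4 * q) = 2 * ENNReal.ofReal (2 * q) := by
        rw [← ENNReal.ofReal_ofNat 2, ← ENNReal.ofReal_mul two_pos.le]
        congr 1
        ring
      rw [h4]
      ring

/-- Burkholder–Rio inequality, with a constant of the right order in `q`. -/
lemma eLpNorm_sum_sq_le_of_condExp_eq_zero {Ω : Type*} {m0 : MeasurableSpace Ω} {μ : Measure Ω}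
    [IsFiniteMeasure μ] {q : ℝ} (hq : 2 ≤ q) {n : ℕ} (M : Fin n → Ω → ℝ)
    (m : Fin n → MeasurableSpace Ω) (hm : ∀ i, m i ≤ m0)
    (hmeas : ∀ i j, j < i → StronglyMeasurable[m i] (M j)) (hint : ∀ i, Integrable (M i) μ)
    (hcond : ∀ i, μ[M i | m i] =ᵐ[μ] 0) :
    eLpNorm (fun ω => ∑ i, M i ω) (ENNReal.ofReal q) μ ^ 2 ≤
      ENNReal.ofReal (4 * q) * ∑ i, eLpNorm (M i) (ENNReal.ofReal q) μ ^ 2 := by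
  induction n with
  | zero => simp
  | succ n ih =>
    have ih := ih (fun i => M i.castSucc) (fun i => m i.castSucc) (fun i => hm _)
      (fun i j hij => hmeas _ _ (Fin.castSucc_lt_castSucc_iff.2 hij)) (fun i => hint _)
      (fun i => hcond _)
    have hX : StronglyMeasurable[m (Fin.last n)] (fun ω => ∑ i : Fin n, M i.castSucc ω) :=
      Finset.stronglyMeasurable_fun_sum _ fun i _ => hmeas _ _ (Fin.castSucc_lt_last i)
    have h := eLpNorm_add_sq_le_of_condExp_eq_zero (hm _) hX
      (integrable_finsetSum _ fun i _ => hint _) (hint _) (hcond (Fin.last n)) hq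
    simp only [Fin.sum_univ_castSucc]
    rw [mul_add]
    exact h.trans (add_le_add_left ih _)



/-- Burkholder–Rio type moment bound for martingale difference sequences with
sub-Weibull (moment-type) increments. -/
theorem stmt5 (c : ℝ) (hc : 0 < c) :
    ∃ c' : ℝ, 0 < c' ∧
      ∀ (Ω : Type) [MeasurableSpace Ω] (μ : Measure Ω) [IsProbabilityMeasure μ]
        (n : ℕ), 0 < n → ∀ (M : Fin n → Ω → ℝ) (K αe : Fin n → ℝ),
        (∀ i, 0 < K i) → (∀ i, 0 < αe i) → (∀ i, Measurable (M i)) →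
        (∀ i : Fin n,
          μ[M i | ⨆ j : Fin n, ⨆ _ : j < i, MeasurableSpace.comap (M j) (borel ℝ)] =ᵐ[μ] 0) →
        (∀ i : Fin n, ∀ q : ℝ, 1 ≤ q →
          eLpNorm (M i) (ENNReal.ofReal q) μ ≤ ENNReal.ofReal (c * K i * q ^ (1 / αe i))) →
        ∀ q : ℝ, 2 ≤ q →
          eLpNorm (fun ω => ∑ i, M i ω) (ENNReal.ofReal q) μ ≤
            ENNReal.ofReal (c' * Real.sqrt (∑ i, K i ^ 2) *
              q ^ (1 / (2 * (⨅ i, αe i) / (2 + ⨅ i, αe i)))) := by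
  refine ⟨2 * c, by positivity, ?_⟩
  intro Ω _ μ _ n hn M K αe hK hα hM hcond hbound q hq
  have : Nonempty (Fin n) := ⟨⟨0, hn⟩⟩
  have hq0 : 0 < q := by linarith
  obtain ⟨i₀, hi₀⟩ := exists_eq_ciInf_of_finite (f := αe)
  set a := ⨅ i, αe i
  have ha : 0 < a := hi₀ ▸ hα i₀
  have hint (i : Fin n) : Integrable (M i) μ := by
    refine memLp_one_iff_integrable.1 ⟨(hM i).aestronglyMeasurable, ?_⟩
    have h := hbound i 1 le_rfl
    rw [ENNReal.ofReal_one] at h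
    exact h.trans_lt ENNReal.ofReal_lt_top
  have hmart := eLpNorm_sum_sq_le_of_condExp_eq_zero hq M
    (fun i => ⨆ j : Fin n, ⨆ _ : j < i, MeasurableSpace.comap (M j) (borel ℝ))
    (fun i => iSup₂_le fun j _ => by
      rw [← BorelSpace.measurable_eq (α := ℝ)]
      exact (hM j).comap_le)
    (fun i j hij => by
      refine Measurable.stronglyMeasurable ?_
      rw [measurable_iff_comap_le, BorelSpace.measurable_eq (α := ℝ)]
      exact le_iSup₂_of_le j hij le_rfl)
    hint hcond
  have hterm (i : Fin n) : eLpNorm (M i) (ENNReal.ofReal q) μ ^ 2 ≤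
      ENNReal.ofReal ((c * K i * q ^ (1 / a)) ^ 2) := by
    have hKi := hK i
    rw [ENNReal.ofReal_pow (by positivity)]
    refine pow_le_pow_left' ((hbound i q (by linarith)).trans (ENNReal.ofReal_le_ofReal ?_)) 2
    refine mul_le_mul_of_nonneg_left ?_ (by positivity)
    exact rpow_le_rpow_of_exponent_le (by linarith)
      (one_div_le_one_div_of_le ha (ciInf_le (Set.finite_range αe).bddBelow i))
  have hexp : q ^ (1 / (2 * a / (2 + a))) = q ^ (1 / a) * √q := by
    rw [sqrt_eq_rpow, ← rpow_add hq0]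
    congr 1
    field_simp
  have hsum : 4 * q * ∑ i, (c * K i * q ^ (1 / a)) ^ 2 =
      (2 * c * √(∑ i, K i ^ 2) * (q ^ (1 / a) * √q)) ^ 2 := by
    simp only [mul_pow, sq_sqrt hq0.le, sq_sqrt (Finset.sum_nonneg fun i _ => sq_nonneg (K i)),
      ← Finset.mul_sum, ← Finset.sum_mul]
    ring
  rw [hexp]
  refine (ENNReal.pow_le_pow_left_iff two_ne_zero).1 (hmart.trans ?_)
  rw [← ENNReal.ofReal_pow (by positivity), ← hsum, ENNReal.ofReal_mul (p := 4 * q) (by positivity),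
    ENNReal.ofReal_sum_of_nonneg fun i _ => sq_nonneg _]
  exact mul_le_mul_right (Finset.sum_le_sum fun i _ => hterm i) _
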